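/- arXiv:1508.05589 — 3 statements merged into one kernel-verified Lean document; each statement's English description precedes it below -/
import Mathlib

section
/- Let k be a field, let f₁, …, fₙ ∈ k[X₁, …, Xₙ], and let A = k[X₁, …, Xₙ]/(f₁, …, fₙ). Suppose the Jacobian matrix (∂fᵢ/∂Xⱼ)₁≤i,j≤n, taken modulo (f₁, …, fₙ), is invertible over A. Then the ideal (f₁, …, fₙ) of k[X₁, …, Xₙ] contains a regular sequence of length n. -/
/-- A sequence `(a 0, …, a (n-1))` in a commutative ring `A` is regular if each `a i`
is a non-zero-divisor in the quotient ring `A / (a j ; j < i)`. -/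
def IsRegularSeq {A : Type*} [CommRing A] {n : ℕ} (a : Fin n → A) : Prop :=
  ∀ i : Fin n,
    Ideal.Quotient.mk (Ideal.span (a '' {j | j < i})) (a i) ∈
      nonZeroDivisors (A ⧸ Ideal.span (a '' {j | j < i}))

open MvPolynomial in
theorem aux_regular {k : Type*} [Field k] {n : ℕ} (p : Fin n → Polynomial k)
    (hp : ∀ i, (p i).Monic) :
    IsRegularSeq (fun i => Polynomial.aeval (X i : MvPolynomial (Fin n) k) (p i)) := by
  intro i
  set J := Ideal.span ((fun i => Polynomial.aeval (X i : MvPolynomial (Fin n) k) (p i)) ''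
    {j | j < i}) with hJ
  let φ : MvPolynomial (Fin n) k →ₐ[k] Polynomial (MvPolynomial (Fin n) k ⧸ J) :=
    aeval (fun j => if j = i then Polynomial.X else Polynomial.C (Ideal.Quotient.mk J (X j)))
  let ε : Polynomial (MvPolynomial (Fin n) k ⧸ J) →ₐ[k] (MvPolynomial (Fin n) k ⧸ J) :=
    (Polynomial.aeval (Ideal.Quotient.mk J (X i))).restrictScalars k
  have hε : ε.comp φ = Ideal.Quotient.mkₐ k J := by
    ext j
    by_cases h : j = i
    · subst h; simp [φ, ε]
    · simp [φ, ε, h]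
  have hφJ : ∀ q ∈ J, φ q = 0 := by
    intro q hq
    have : J ≤ RingHom.ker φ := by
      refine Ideal.span_le.2 ?_
      rintro _ ⟨j, hj, rfl⟩
      have hne : j ≠ i := ne_of_lt hj
      have h0 : Ideal.Quotient.mkₐ k J (Polynomial.aeval (X j : MvPolynomial (Fin n) k) (p j)) = 0 :=
        Ideal.Quotient.eq_zero_iff_mem.2 (Ideal.subset_span ⟨j, hj, rfl⟩)
      have h1 : φ (X j) = Polynomial.CAlgHom (R := k) (Ideal.Quotient.mkₐ k J (X j)) := by
        simp [φ, hne]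
      simp only [SetLike.mem_coe, RingHom.mem_ker]
      rw [← Polynomial.aeval_algHom_apply, h1, Polynomial.aeval_algHom_apply,
        Polynomial.aeval_algHom_apply, h0, map_zero]
    exact this hq
  have hφi : φ (Polynomial.aeval (X i : MvPolynomial (Fin n) k) (p i))
      = (p i).map (algebraMap k _) := by
    rw [← Polynomial.aeval_algHom_apply]
    have h1 : φ (X i) = Polynomial.X := by simp [φ]
    rw [h1, Polynomial.aeval_X_left_eq_map]
  rw [mem_nonZeroDivisors_iff_right]
  intro x hx
  obtain ⟨q, rfl⟩ := Ideal.Quotient.mk_surjective x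
  rw [← map_mul, Ideal.Quotient.eq_zero_iff_mem] at hx
  have h2 := hφJ _ hx
  rw [map_mul, hφi] at h2
  have h3 : φ q = 0 := (((hp i).map _).mul_left_eq_zero_iff).1 h2
  have h4 := DFunLike.congr_fun hε q
  simpa [h3] using h4.symm

theorem aux_lin {A M : Type*} [CommRing A] [AddCommGroup M] [Module A M] {n : ℕ}
    (B N : Matrix (Fin n) (Fin n) A) (hN : N * B = 1) (v : Fin n → M)
    (hv : ∀ i, ∑ l, B i l • v l = 0) (j : Fin n) : v j = 0 := by
  have h2 : ∑ i, N j i • ∑ l, B i l • v l = 0 := by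
    simp [hv]
  simp only [Finset.smul_sum, smul_smul] at h2
  rw [Finset.sum_comm] at h2
  simp only [← Finset.sum_smul, ← Matrix.mul_apply, hN] at h2
  simpa [Matrix.one_apply, ite_smul] using h2

open MvPolynomial in
theorem aux_unram {k : Type*} [Field k] {n : ℕ} (f : Fin n → MvPolynomial (Fin n) k)
    (hJ : IsUnit (Matrix.of fun i j : Fin n =>
      Ideal.Quotient.mk (Ideal.span (Set.range f)) (MvPolynomial.pderiv j (f i)))) :
    Algebra.FormallyUnramified k (MvPolynomial (Fin n) k ⧸ Ideal.span (Set.range f)) := by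
  set I := Ideal.span (Set.range f) with hI
  let A := MvPolynomial (Fin n) k ⧸ I
  let D := KaehlerDifferential.D k A
  let d : Derivation k (MvPolynomial (Fin n) k) (Ω[A⁄k]) := D.compAlgebraMap (MvPolynomial (Fin n) k)
  have hd : ∀ p, D (Ideal.Quotient.mk I p) = d p := fun p => rfl
  have hsum : ∀ (F : Fin n → Derivation k (MvPolynomial (Fin n) k) (Ω[A⁄k])) p,
      (∑ j, F j) p = ∑ j, F j p := by
    intro F p
    have := map_sum (Derivation.coeFnAddMonoidHom (R := k) (A := MvPolynomial (Fin n) k)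
      (M := Ω[A⁄k])) F Finset.univ
    have h := congrFun this p
    rw [Finset.sum_apply] at h
    exact h
  have key : ∀ p, d p = ∑ j, Ideal.Quotient.mk I (pderiv j p) • d (X j) := by
    intro p
    have : d = ∑ j, (LinearMap.toSpanSingleton (MvPolynomial (Fin n) k) (Ω[A⁄k]) (d (X j))).compDer
        (pderiv j) := by
      apply MvPolynomial.derivation_ext
      intro i
      rw [hsum, Finset.sum_eq_single i]
      · simp
      · intro b _ hb
        simp [pderiv_X_of_ne hb.symm]
      · simp
    conv_lhs => rw [this]
    rw [hsum]
    refine Finset.sum_congr rfl fun j _ => ?_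
    exact (algebraMap_smul A (pderiv j p) (d (X j))).symm
  obtain ⟨N, hN⟩ := hJ.exists_left_inv
  have hz : ∀ j, d (X j) = 0 := by
    intro j
    have h1 : ∀ i, ∑ l, Ideal.Quotient.mk I (pderiv l (f i)) • d (X l) = 0 := by
      intro i
      have hm : Ideal.Quotient.mk I (f i) = 0 :=
        Ideal.Quotient.eq_zero_iff_mem.2 (Ideal.subset_span ⟨i, rfl⟩)
      rw [← key, ← hd, hm, map_zero]
    exact aux_lin _ _ hN (fun l => d (X l)) h1 j
  rw [Algebra.formallyUnramified_iff]
  have htop : (⊤ : Submodule A (Ω[A⁄k])) = ⊥ := by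
    rw [← KaehlerDifferential.span_range_derivation, Submodule.span_eq_bot]
    rintro _ ⟨x, rfl⟩
    obtain ⟨p, rfl⟩ := Ideal.Quotient.mk_surjective x
    change d p = 0
    rw [key]
    simp [hz]
  exact (Submodule.subsingleton_iff A).1 (subsingleton_of_bot_eq_top htop.symm)

/-- If `k` is a field and the Jacobian matrix of `(f₁, …, fₙ)` is invertible modulo
`(f₁, …, fₙ)`, then the ideal `(f₁, …, fₙ)` contains a regular sequence of length `n`. -/
theorem invertible_jacobian_ideal_contains_regular_sequence
    {k : Type*} [Field k] {n : ℕ} (f : Fin n → MvPolynomial (Fin n) k)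
    (hJ : IsUnit (Matrix.of fun i j : Fin n =>
      Ideal.Quotient.mk (Ideal.span (Set.range f)) (MvPolynomial.pderiv j (f i)))) :
    ∃ g : Fin n → MvPolynomial (Fin n) k,
      (∀ i, g i ∈ Ideal.span (Set.range f)) ∧ IsRegularSeq g := by
  have := aux_unram f hJ
  have hfin : Module.Finite k (MvPolynomial (Fin n) k ⧸ Ideal.span (Set.range f)) :=
    Algebra.FormallyUnramified.finite_of_free _ _
  have hint : ∀ i : Fin n, IsIntegral k
      (Ideal.Quotient.mkₐ k (Ideal.span (Set.range f)) (MvPolynomial.X i)) :=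
    fun i => Algebra.IsIntegral.isIntegral _
  choose p hp hp0 using hint
  refine ⟨_, fun i => ?_, aux_regular p hp⟩
  rw [← Ideal.Quotient.eq_zero_iff_mem]
  have h := hp0 i
  rw [← Polynomial.aeval_def, Polynomial.aeval_algHom_apply] at h
  exact h
end

section
/- (de Smit–Lenstra) Let k be an arbitrary commutative ring, let f₁, …, fₙ ∈ k[X₁, …, Xₙ] (as many polynomials as variables), and let A = k[X₁, …, Xₙ]/(f₁, …, fₙ). If A is finitely generated as a k-module, then A is flat as a k-module. -/
open RingTheory.Sequence
open TensorProduct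

lemma dsl_lift {R V M N : Type*} [CommRing R] [AddCommGroup V] [Module R V] [Module.Free R V]
    [AddCommGroup M] [Module R M] [AddCommGroup N] [Module R N] (g : M →ₗ[R] N)
    (hg : Function.Surjective g) (i : ℕ) (u : V [⋀^Fin i]→ₗ[R] N) :
    ∃ w : V [⋀^Fin i]→ₗ[R] M, g.compAlternatingMap w = u := by
  obtain ⟨h, hh⟩ := Module.projective_lifting_property g
    (exteriorPower.alternatingMapLinearEquiv u) hg
  refine ⟨exteriorPower.alternatingMapLinearEquiv.symm h, ?_⟩
  ext v
  have := LinearMap.congr_fun hh (exteriorPower.ιMulti R i v)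
  simpa using this

lemma dsl_homotopy {R V M : Type*} [CommRing R] [AddCommGroup V] [Module R V]
    [AddCommGroup M] [Module R M] (e : V →ₗ[R] R) (f : V) (i : ℕ)
    (z : V [⋀^Fin (i + 1)]→ₗ[R] M) (hz : z.curryLeft f = 0) :
    ∃ w : V [⋀^Fin (i + 2)]→ₗ[R] M, w.curryLeft f = e f • z := by
  refine ⟨AlternatingMap.alternatizeUncurryFin (e.smulRight z), ?_⟩
  ext v
  rw [AlternatingMap.curryLeft_apply_apply, AlternatingMap.alternatizeUncurryFin_apply,
    Fin.sum_univ_succ, Finset.sum_eq_zero]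
  · simp
  · intro j _
    have h : z (Fin.removeNth j.succ (Matrix.vecCons f v)) = 0 := by
      have h1 : Fin.removeNth j.succ (Matrix.vecCons f v) =
          Matrix.vecCons f (Fin.removeNth j v) := by
        ext l
        refine Fin.cases ?_ (fun l => ?_) l <;> simp [Fin.removeNth]
      rw [h1, ← AlternatingMap.curryLeft_apply_apply, hz]
      rfl
    simp [h]

lemma dsl_koszul {R : Type*} [CommRing R] {n : ℕ} (f : Fin n → R) (ps : List R) :
    ∀ {M : Type*} [AddCommGroup M] [Module R M] (_ : IsWeaklyRegular M ps)
    (_ : ∀ p ∈ ps, p ∈ Ideal.span (Set.range f)) (i : ℕ) (_ : n < i + 1 + ps.length)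
    (z : (Fin n → R) [⋀^Fin (i + 1)]→ₗ[R] M) (_ : z.curryLeft f = 0),
    ∃ w : (Fin n → R) [⋀^Fin (i + 2)]→ₗ[R] M, w.curryLeft f = z := by
  induction ps with
  | nil =>
    intro M _ _ _ _ i hi z _
    refine ⟨0, ?_⟩
    refine Module.Basis.ext_alternating (Pi.basisFun R (Fin n)) fun v hv => ?_
    have := Fintype.card_le_of_injective v hv
    simp at this hi
    omega
  | cons p ps ih =>
    intro M _ _ hreg hmem i hi z hz
    rw [isWeaklyRegular_cons_iff] at hreg
    obtain ⟨hp, hreg⟩ := hreg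
    obtain ⟨c, hc⟩ := (Ideal.mem_span_range_iff_exists_fun).1 (hmem p (by simp))
    let e : (Fin n → R) →ₗ[R] R := Fintype.linearCombination R c
    have he : e f = p := by
      rw [← hc]; simp [e, Fintype.linearCombination_apply, mul_comm]
    obtain ⟨w, hw⟩ := dsl_homotopy e f i z hz
    rw [he] at hw
    let g : M →ₗ[R] QuotSMulTop p M := Submodule.mkQ _
    have hg : Function.Surjective g := Submodule.mkQ_surjective _
    obtain ⟨u, hu⟩ := ih hreg (fun q hq => hmem q (by simp [hq])) (i + 1)
      (by simp at hi ⊢; omega) (g.compAlternatingMap w) (by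
        ext v
        have := congrArg (fun t => g (t v)) hw
        simp only [AlternatingMap.curryLeft_apply_apply] at this
        simp only [AlternatingMap.curryLeft_apply_apply, LinearMap.compAlternatingMap_apply]
        rw [this]
        refine (Submodule.Quotient.mk_eq_zero _).2 ?_
        exact Submodule.smul_mem_pointwise_smul _ _ _ trivial)
    obtain ⟨u', rfl⟩ := dsl_lift g hg _ u
    let t := w - u'.curryLeft f
    have ht : ∀ v, t v ∈ LinearMap.range (LinearMap.lsmul R M p) := by
      intro v
      have h1 : g (t v) = 0 := by
        have := congrArg (fun t => t v) hu
        simp only [AlternatingMap.curryLeft_apply_apply,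
          LinearMap.compAlternatingMap_apply] at this
        simp [t, this]
      have h2 := (Submodule.Quotient.mk_eq_zero _).1 h1
      obtain ⟨m, -, hm⟩ := h2
      exact ⟨m, hm⟩
    let E := LinearEquiv.ofInjective (LinearMap.lsmul R M p) hp
    let s := E.symm.toLinearMap.compAlternatingMap (t.codRestrict _ ht)
    have hs : ∀ v, p • s v = t v := by
      intro v
      have := congrArg Subtype.val (E.apply_symm_apply ⟨t v, ht v⟩)
      exact this
    refine ⟨s, ?_⟩
    ext v
    apply hp
    simp only [AlternatingMap.curryLeft_apply_apply, hs, t]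
    have := congrArg (fun t => t v) hw
    simp only [AlternatingMap.curryLeft_apply_apply] at this
    simp only [AlternatingMap.sub_apply, this, AlternatingMap.curryLeft_apply_apply]
    rw [u'.map_eq_zero_of_eq (i := 0) (j := 1)]
    · simp
    · simp
    · simp

lemma dsl_regular {R : Type*} [CommRing R] (n : ℕ) (p : Fin n → Polynomial R)
    (hp : ∀ i, (p i).Monic) :
    IsWeaklyRegular (MvPolynomial (Fin n) R)
      (List.ofFn fun i => Polynomial.aeval (MvPolynomial.X i : MvPolynomial (Fin n) R) (p i)) := by
  induction n with
  | zero => simp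
  | succ n ih =>
    let S := MvPolynomial (Fin n) R
    let e := MvPolynomial.finSuccEquiv R n
    let P : Polynomial S := (p 0).map MvPolynomial.C
    have hP : P.Monic := (hp 0).map _
    let rs : List S := List.ofFn fun i : Fin n =>
      Polynomial.aeval (MvPolynomial.X i : MvPolynomial (Fin n) R) (p i.succ)
    have hrs : IsWeaklyRegular S rs := ih _ fun i => hp _
    have key : IsWeaklyRegular (Polynomial S) (P :: rs.map (algebraMap S (Polynomial S))) := by
      rw [isWeaklyRegular_cons_iff]
      constructor
      · intro a b hab
        exact hP.isRegular.left hab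
      · rw [isWeaklyRegular_map_algebraMap_iff]
        have e1 : QuotSMulTop P (Polynomial S) ≃ₗ[Polynomial S]
            (Polynomial S ⧸ Ideal.span {P}) := 
          Submodule.quotEquivOfEq _ _ (by
            ext x
            simp [Submodule.mem_smul_pointwise_iff_exists, Ideal.mem_span_singleton, dvd_def, eq_comm])
        have e2 := e1.restrictScalars S
        rw [e2.isWeaklyRegular_congr]
        have := hP.free_quotient
        have h3 := hrs.isWeaklyRegular_lTensor (M₂ := Polynomial S ⧸ Ideal.span {P})
        rwa [(TensorProduct.rid S _).isWeaklyRegular_congr] at h3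
    refine (AddEquiv.isWeaklyRegular_congr (e := e.toAddEquiv) ?_).2 key
    rw [List.ofFn_succ]
    refine List.Forall₂.cons ?_ ?_
    · intro x
      have h : e (Polynomial.aeval (MvPolynomial.X 0) (p 0)) = P := by
        rw [← Polynomial.aeval_algHom_apply, MvPolynomial.finSuccEquiv_X_zero]
        simp [P, Polynomial.aeval_def, Polynomial.map, Polynomial.eval₂_eq_sum]
      change e (_ * x) = P * e x
      rw [map_mul, h]
    · simp only [rs, List.map_ofFn]
      rw [List.forall₂_iff_get]
      refine ⟨by simp, fun i h₁ h₂ x => ?_⟩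
      simp only [List.get_ofFn]
      have h : ∀ j : Fin n, e (Polynomial.aeval (MvPolynomial.X j.succ) (p j.succ)) =
          Polynomial.C (Polynomial.aeval (MvPolynomial.X j) (p j.succ)) := by
        intro j
        rw [← Polynomial.aeval_algHom_apply, MvPolynomial.finSuccEquiv_X_succ]
        exact Polynomial.aeval_algebraMap_apply (A := S) (Polynomial S) _ _
      change e (_ * x) = _ * e x
      rw [map_mul, h]
      rfl

lemma dsl_flat {k S : Type*} [CommRing k] [CommRing S] [Algebra k S] [Module.Flat k S]
    (J : Ideal S)
    (h : ∀ (I : Ideal k) (x : S), x ∈ J → x ∈ I.map (algebraMap k S) →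
      x ∈ I.map (algebraMap k S) * J) : Module.Flat k (S ⧸ J) := by
  rw [Module.Flat.iff_rTensor_injective]
  intro I _
  let π : S →ₗ[k] S ⧸ J := (Ideal.Quotient.mkₐ k J).toLinearMap
  have hπ : Function.Surjective π := Ideal.Quotient.mk_surjective
  let φ : I ⊗[k] S →ₗ[k] S := (TensorProduct.lid k S).toLinearMap ∘ₗ I.subtype.rTensor S
  have hφ : Function.Injective φ := by
    have := Module.Flat.rTensor_preserves_injective_linearMap (M := S) I.subtype
      Subtype.val_injective
    exact (TensorProduct.lid k S).injective.comp this
  have hφt : ∀ c s, φ (c ⊗ₜ s) = (c : k) • s := fun c s => by simp [φ]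
  rw [injective_iff_map_eq_zero]
  intro t ht
  obtain ⟨t, rfl⟩ := LinearMap.lTensor_surjective I hπ t
  have hcomp : ∀ t, TensorProduct.lid k (S ⧸ J) (I.subtype.rTensor (S ⧸ J) (π.lTensor I t)) =
      π (φ t) := by
    intro t
    induction t with
    | zero => simp
    | add x y hx hy => simp only [map_add, hx, hy]
    | tmul c s => simp [φ]
  have h1 : φ t ∈ J := by
    have := hcomp t
    rw [ht, map_zero] at this
    exact Ideal.Quotient.eq_zero_iff_mem.1 this.symm
  have h2 : ∀ t, φ t ∈ I.map (algebraMap k S) := by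
    intro t
    induction t with
    | zero => simp
    | add x y hx hy => rw [map_add]; exact add_mem hx hy
    | tmul c s =>
      rw [hφt, Algebra.smul_def]
      exact Ideal.mul_mem_right _ _ (Ideal.mem_map_of_mem _ c.2)
  have h3 : ∀ y ∈ I.map (algebraMap k S), ∀ j ∈ J,
      y * j ∈ (LinearMap.ker (π.lTensor I)).map φ := by
    intro y hy
    induction hy using Submodule.span_induction with
    | mem x hx =>
      obtain ⟨c, hc, rfl⟩ := hx
      intro j hj
      refine ⟨(⟨c, hc⟩ : I) ⊗ₜ j, ?_, ?_⟩
      · have : π j = 0 := Ideal.Quotient.eq_zero_iff_mem.2 hj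
        simp [this]
      · rw [hφt, Algebra.smul_def]
    | zero => intro j _; simp
    | add x y _ _ hx hy =>
      intro j hj
      rw [add_mul]; exact add_mem (hx j hj) (hy j hj)
    | smul a x _ hx =>
      intro j hj
      have := hx (a * j) (J.mul_mem_left _ hj)
      rwa [smul_eq_mul, mul_comm a x, mul_assoc]
  have h4 : φ t ∈ (LinearMap.ker (π.lTensor I)).map φ := by
    refine Submodule.mul_induction_on (h I _ h1 (h2 t)) h3 fun x y hx hy => add_mem hx hy
  obtain ⟨t', ht', he⟩ := h4
  rw [← hφ he]
  exact ht'

/-- (de Smit–Lenstra) If `A = k[X₁,…,Xₙ]/(f₁,…,fₙ)` (as many polynomials as variables)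
is finitely generated as a `k`-module, then `A` is flat over `k`. -/
theorem deSmit_Lenstra_flat
    {k : Type*} [CommRing k] {n : ℕ} (f : Fin n → MvPolynomial (Fin n) k)
    (hfin : Module.Finite k (MvPolynomial (Fin n) k ⧸ Ideal.span (Set.range f))) :
    Module.Flat k (MvPolynomial (Fin n) k ⧸ Ideal.span (Set.range f)) := by
  have hint : ∀ i : Fin n, ∃ p : Polynomial k, p.Monic ∧
      Polynomial.aeval (MvPolynomial.X i : MvPolynomial (Fin n) k) p ∈
        Ideal.span (Set.range f) := by
    intro i
    obtain ⟨p, hp, h0⟩ := Algebra.IsIntegral.isIntegral (R := k)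
      (Ideal.Quotient.mkₐ k (Ideal.span (Set.range f)) (MvPolynomial.X i))
    refine ⟨p, hp, ?_⟩
    rw [← Polynomial.aeval_def, Polynomial.aeval_algHom_apply] at h0
    exact Ideal.Quotient.eq_zero_iff_mem.1 h0
  choose p hp hpf using hint
  refine dsl_flat _ fun I x hxJ hxI => ?_
  let S := MvPolynomial (Fin n) k
  let S' := MvPolynomial (Fin n) (k ⧸ I)
  let _ : Algebra S S' := MvPolynomial.algebraMvPolynomial
  have : IsScalarTower k S S' := IsScalarTower.of_algebraMap_eq' (by
    ext r : 1
    exact (MvPolynomial.map_C _ _).symm)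
  let g : S →ₗ[S] S' := Algebra.linearMap S S'
  have hgm : ∀ s, g s = MvPolynomial.map (Ideal.Quotient.mk I) s := fun s => rfl
  have hg : Function.Surjective g :=
    MvPolynomial.map_surjective _ Ideal.Quotient.mk_surjective
  have hker : ∀ s, g s = 0 ↔ s ∈ I.map (algebraMap k S) := by
    intro s
    have := MvPolynomial.ker_map (σ := Fin n) (Ideal.Quotient.mk I)
    rw [Ideal.mk_ker] at this
    rw [hgm, ← RingHom.mem_ker, this]
    rfl
  let ps : List S := List.ofFn fun i => Polynomial.aeval (MvPolynomial.X i : S) (p i)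
  have hps : IsWeaklyRegular S' ps := by
    rw [← isWeaklyRegular_map_algebraMap_iff S']
    have := dsl_regular n (fun i => (p i).map (Ideal.Quotient.mk I)) fun i => (hp i).map _
    convert this using 1
    simp only [ps, List.map_ofFn]
    congr 1
    ext1 i
    have h5 : algebraMap S S' (MvPolynomial.X i) = MvPolynomial.X i :=
      MvPolynomial.map_X (Ideal.Quotient.mk I) i
    have h6 := Polynomial.aeval_algebraMap_apply (R := k) (A := S) S' (MvPolynomial.X i) (p i)
    rw [Function.comp_apply, ← h6, h5]
    exact (Polynomial.aeval_map_algebraMap (k ⧸ I) _ (p i)).symm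
  obtain ⟨a, ha⟩ := (Ideal.mem_span_range_iff_exists_fun).1 hxJ
  let ℓ : (Fin n → S) →ₗ[S] S := Fintype.linearCombination S a
  have hℓ : ℓ f = x := by
    rw [← ha]; simp [ℓ, Fintype.linearCombination_apply, mul_comm]
  let z : (Fin n → S) [⋀^Fin 1]→ₗ[S] S' :=
    AlternatingMap.ofSubsingleton S (Fin n → S) S' (0 : Fin 1) (g ∘ₗ ℓ)
  have hzv : ∀ v, z v = g (ℓ (v 0)) := fun v => rfl
  obtain ⟨w, hw⟩ := dsl_koszul f ps hps (by
      intro q hq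
      obtain ⟨i, rfl⟩ := List.mem_ofFn.1 hq
      exact hpf i) 0 (by simp [ps]) z (by
      refine AlternatingMap.ext fun v => ?_
      rw [AlternatingMap.curryLeft_apply_apply, hzv]
      simp only [Matrix.cons_val_zero, hℓ]
      simpa using (hker x).2 hxI)
  obtain ⟨W, rfl⟩ := dsl_lift g hg _ w
  let m : (Fin n → S) →ₗ[S] S :=
    ℓ - (AlternatingMap.ofSubsingleton S (Fin n → S) S (0 : Fin 1)).symm (W.curryLeft f)
  have hm : ∀ v, m v = ℓ v - W ![f, v] := by
    intro v
    simp only [m, LinearMap.sub_apply]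
    congr 1
    change W _ = W _
    congr 1
    ext i : 1
    fin_cases i <;> rfl
  have hmI : ∀ v, m v ∈ I.map (algebraMap k S) := by
    intro v
    rw [← hker, hm, map_sub, sub_eq_zero]
    have := congrArg (fun t => t ![v]) hw
    exact this.symm
  have hmf : m f = x := by
    rw [hm, hℓ, W.map_eq_zero_of_eq (i := 0) (j := 1), sub_zero]
    · simp
    · simp
  rw [← hmf, LinearMap.pi_apply_eq_sum_univ m f]
  refine Ideal.sum_mem _ fun i _ => ?_
  rw [smul_eq_mul, mul_comm (f i)]
  exact Ideal.mul_mem_mul (hmI _) (Ideal.subset_span ⟨i, rfl⟩)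
end

section
/- (de Smit–Lenstra) Let k be an arbitrary commutative ring, let f₁, …, fₙ ∈ k[X₁, …, Xₙ] (as many polynomials as variables), and let A = k[X₁, …, Xₙ]/(f₁, …, fₙ). If A is finitely generated as a k-module, then A is a finitely generated projective k-module. -/
open MvPolynomial in
theorem dsl_sub_C_eval_mem {σ S : Type*} [CommRing S] (x : σ → S) (h : MvPolynomial σ S) :
    h - C (eval x h) ∈ Ideal.span (Set.range fun i => (X i - C (x i) : MvPolynomial σ S)) := by
  set I := Ideal.span (Set.range fun i => (X i - C (x i) : MvPolynomial σ S)) with hI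
  rw [← Ideal.Quotient.eq]
  have : (Ideal.Quotient.mk I) = ((Ideal.Quotient.mk I).comp C).comp (eval x) := by
    apply MvPolynomial.ringHom_ext
    · intro r; simp
    · intro i
      simp only [RingHom.comp_apply, eval_X]
      rw [Ideal.Quotient.eq]
      exact Ideal.subset_span ⟨i, rfl⟩
  exact congrArg (fun φ => φ h) this

open MvPolynomial in
theorem dsl_dvd_sub {σ S : Type*} [DecidableEq σ] [CommRing S] (i : σ) (a : S)
    (h : MvPolynomial σ S) :
    (X i - C a) ∣ h - aeval (Function.update X i (C a)) h := by
  rw [← Ideal.mem_span_singleton, ← Ideal.Quotient.eq]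
  set I := Ideal.span {(X i - C a : MvPolynomial σ S)} with hI
  have : (Ideal.Quotient.mkₐ S I) = (Ideal.Quotient.mkₐ S I).comp
      (aeval (Function.update X i (C a))) := by
    apply MvPolynomial.algHom_ext
    intro j
    simp only [AlgHom.comp_apply, aeval_X]
    by_cases hj : j = i
    · subst hj
      simp only [Function.update_self, Ideal.Quotient.mkₐ_eq_mk]
      rw [Ideal.Quotient.eq]
      exact Ideal.subset_span rfl
    · simp [Function.update_of_ne hj]
  exact congrArg (fun φ => φ h) this

open MvPolynomial in
theorem dsl_X_sub_C_cancel {σ S : Type*} [CommRing S] (i : σ) (a : S)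
    (u v : MvPolynomial σ S) (h : (X i - C a) * u = (X i - C a) * v) : u = v := by
  let θ : MvPolynomial σ S →ₐ[S] MvPolynomial σ S := aeval fun j => X j + C a
  let η : MvPolynomial σ S →ₐ[S] MvPolynomial σ S := aeval fun j => X j - C a
  have hη : ∀ w, η (θ w) = w := by
    have : η.comp θ = AlgHom.id S _ := by
      apply MvPolynomial.algHom_ext
      intro j
      simp [η, θ, algHom_C]
    exact fun w => congrArg (fun φ => φ w) this
  have h2 := congrArg θ h
  have h3 : θ (X i - C a) = X i := by simp [θ, algHom_C]
  rw [map_mul, map_mul, h3] at h2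
  have h4 := isRegular_X.left h2
  rw [← hη u, h4, hη]

open MvPolynomial in
theorem dsl_cancel_mem {σ S : Type*} [Fintype σ] [DecidableEq σ] [CommRing S]
    (x : σ → S) (p : σ → Polynomial S)
    (i : σ) (v : MvPolynomial σ S) (q : σ → MvPolynomial σ S) (hq : q i = 0)
    (h : (X i - C (x i)) * v = ∑ j, q j * Polynomial.aeval (X j) (p j)) :
    v ∈ Ideal.span (Set.range fun j => Polynomial.aeval (X j : MvPolynomial σ S) (p j)) := by
  choose r hr using fun j => dsl_dvd_sub i (x i) (q j)
  have h2 := congrArg (aeval (Function.update X i (C (x i)))) h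
  simp only [map_mul, map_sub, aeval_X, Function.update_self, algHom_C, map_sum] at h2
  have h3 : ∑ j, (aeval (Function.update X i (C (x i))) (q j)) *
      Polynomial.aeval (X j) (p j) = 0 := by
    trans ∑ j, (aeval (Function.update X i (C (x i))) (q j)) *
      (aeval (Function.update X i (C (x i)))) (Polynomial.aeval (X j : MvPolynomial σ S) (p j))
    · refine Finset.sum_congr rfl fun j _ => ?_
      by_cases hj : j = i
      · subst hj; simp [hq]
      · rw [← Polynomial.aeval_algHom_apply, aeval_X, Function.update_of_ne hj]
    · rw [← h2]; simp
  have h4 : v = ∑ j, r j * Polynomial.aeval (X j) (p j) := by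
    apply dsl_X_sub_C_cancel i (x i)
    rw [h, Finset.mul_sum, ← sub_zero (∑ j, q j * _), ← h3, ← Finset.sum_sub_distrib]
    refine Finset.sum_congr rfl fun j _ => ?_
    rw [← sub_mul, hr, mul_assoc]
  rw [h4]
  exact Ideal.sum_mem _ fun j _ => Ideal.mul_mem_left _ _ (Ideal.subset_span ⟨j, rfl⟩)

open Matrix in
theorem dsl_det {σ P : Type*} [Fintype σ] [DecidableEq σ] [CommRing P] (t g : σ → P)
    (H : ∀ (i : σ) (v : P) (q : σ → P), q i = 0 → t i * v = ∑ j, q j * g j →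
      v ∈ Ideal.span (Set.range g))
    (M M' : Matrix σ σ P) (hM : M *ᵥ t = g) (hM' : M' *ᵥ t = g) :
    M.det - M'.det ∈ Ideal.span (Set.range g) := by
  have key : ∀ s : Finset σ,
      (Matrix.of fun i => if i ∈ s then M i else M' i).det - M'.det ∈ Ideal.span (Set.range g) := by
    intro s
    induction s using Finset.induction_on with
    | empty => simp only [Finset.notMem_empty, if_false]; simp [show Matrix.of (fun i => M' i) = M' from rfl]
    | insert i s his ih =>
      set N := (Matrix.of fun i => if i ∈ s then M i else M' i) with hN
      have hNi : N i = M' i := by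
        show (if i ∈ s then M i else M' i) = M' i
        rw [if_neg his]
      have e1 : (Matrix.of fun j => if j ∈ insert i s then M j else M' j) =
          N.updateRow i (N i + (M i - M' i)) := by
        ext j l
        by_cases hj : j = i
        · subst hj; simp [hNi]
        · simp [hj, hN]
      have hNt : ∀ j, N j ⬝ᵥ t = g j := by
        intro j
        show (if j ∈ s then M j else M' j) ⬝ᵥ t = g j
        by_cases hj : j ∈ s
        · rw [if_pos hj]; exact congrFun hM j
        · rw [if_neg hj]; exact congrFun hM' j
      rw [e1, Matrix.det_updateRow_add, Matrix.updateRow_eq_self, add_sub_right_comm]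
      refine Ideal.add_mem _ ih ?_
      set K := N.updateRow i (M i - M' i) with hK
      have hKt : K *ᵥ t = Function.update g i 0 := by
        ext j
        by_cases hj : j = i
        · subst hj
          have a1 : M j ⬝ᵥ t = g j := congrFun hM j
          have a2 : M' j ⬝ᵥ t = g j := congrFun hM' j
          have a3 : (M j - M' j) ⬝ᵥ t = 0 := by rw [sub_dotProduct, a1, a2, sub_self]
          have a4 : K j = M j - M' j := by rw [hK, Matrix.updateRow_self]
          rw [Function.update_self]
          show K j ⬝ᵥ t = 0
          rw [a4, a3]
        · simpa [hK, Matrix.mulVec, hj] using hNt j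
      have hadj := congrArg (fun w => (K.adjugate *ᵥ w) i) hKt
      simp only [Matrix.mulVec_mulVec, Matrix.adjugate_mul, Matrix.smul_mulVec, Matrix.one_mulVec,
        Pi.smul_apply, smul_eq_mul] at hadj
      refine H i _ (Function.update (K.adjugate i) i 0) (by simp) ?_
      rw [mul_comm, hadj]
      simp only [Matrix.mulVec, dotProduct]
      refine Finset.sum_congr rfl fun j _ => ?_
      by_cases hj : j = i
      · subst hj; simp
      · simp [hj]
  have := key Finset.univ
  simpa [show Matrix.of (fun i => M i) = M from rfl] using this

noncomputable def dslL {S : Type*} [CommRing S] (w : ℕ → S) : Polynomial S →ₗ[S] S :=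
  (Polynomial.basisMonomials S).constr S w

theorem dslL_X_pow {S : Type*} [CommRing S] (w : ℕ → S) (m : ℕ) :
    dslL w (Polynomial.X ^ m) = w m := by
  have := (Polynomial.basisMonomials S).constr_basis S w m
  simpa [dslL, Polynomial.X_pow_eq_monomial] using this

noncomputable def dslF {σ S : Type*} [Fintype σ] [CommRing S] (w : σ → ℕ → S) :
    MvPolynomial σ S →ₗ[S] S :=
  (MvPolynomial.basisMonomials σ S).constr S fun m => ∏ i, w i (m i)

theorem dslF_monomial {σ S : Type*} [Fintype σ] [CommRing S] (w : σ → ℕ → S) (m : σ →₀ ℕ) :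
    dslF w (MvPolynomial.monomial m 1) = ∏ i, w i (m i) := by
  have := (MvPolynomial.basisMonomials σ S).constr_basis S (fun m => ∏ i, w i (m i)) m
  simpa [dslF] using this

theorem dslF_prod {σ S : Type*} [Fintype σ] [CommRing S] (w : σ → ℕ → S)
    (q : σ → Polynomial S) :
    dslF w (∏ i, Polynomial.aeval (MvPolynomial.X i) (q i)) = ∏ i, dslL (w i) (q i) := by
  classical
  let F1 : MultilinearMap S (fun _ : σ => Polynomial S) S :=
    (dslF w).compMultilinearMap ((MultilinearMap.mkPiAlgebra S σ (MvPolynomial σ S)).compLinearMap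
      fun i => (Polynomial.aeval (MvPolynomial.X i : MvPolynomial σ S)).toLinearMap)
  let F2 : MultilinearMap S (fun _ : σ => Polynomial S) S :=
    (MultilinearMap.mkPiAlgebra S σ S).compLinearMap fun i => dslL (w i)
  have : F1 = F2 := by
    refine Module.Basis.ext_multilinear (fun _ => Polynomial.basisMonomials S) fun v => ?_
    simp only [F1, F2, LinearMap.compMultilinearMap_apply, MultilinearMap.compLinearMap_apply,
      MultilinearMap.mkPiAlgebra_apply, Polynomial.coe_basisMonomials, AlgHom.toLinearMap_apply,
      ← Polynomial.X_pow_eq_monomial, dslL_X_pow, map_pow, Polynomial.aeval_X]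
    have e := dslF_monomial w (Finsupp.equivFunOnFinite.symm v)
    rw [MvPolynomial.monomial_eq, Finsupp.prod_fintype _ _ (by simp)] at e
    simpa using e
  exact congrArg (fun φ => φ q) this

theorem dslF_mul_eq_zero {σ S : Type*} [Fintype σ] [CommRing S] (w : σ → ℕ → S)
    (i : σ) (p : Polynomial S) (hp : ∀ m, dslL (w i) (p * Polynomial.X ^ m) = 0)
    (h : MvPolynomial σ S) :
    dslF w (h * Polynomial.aeval (MvPolynomial.X i) p) = 0 := by
  classical
  have : (dslF w).comp (LinearMap.mulRight S
      (Polynomial.aeval (MvPolynomial.X i : MvPolynomial σ S) p)) = 0 := by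
    refine (MvPolynomial.basisMonomials σ S).ext fun m => ?_
    have e := dslF_prod w (fun j => (if j = i then p else 1) * Polynomial.X ^ (m j))
    have e0 : ∏ j, dslL (w j) ((if j = i then p else 1) * Polynomial.X ^ (m j)) = 0 :=
      Finset.prod_eq_zero (Finset.mem_univ i) (by simpa using hp (m i))
    rw [e0] at e
    simp only [LinearMap.comp_apply, MvPolynomial.coe_basisMonomials, LinearMap.mulRight_apply,
      LinearMap.zero_apply]
    rw [MvPolynomial.monomial_eq, Finsupp.prod_fintype _ _ (by simp), ← e]
    simp only [map_mul, Finset.prod_mul_distrib, map_pow, Polynomial.aeval_X, map_one, one_mul]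
    have e1 : ∏ j, Polynomial.aeval (MvPolynomial.X j : MvPolynomial σ S)
        (if j = i then p else 1) = Polynomial.aeval (MvPolynomial.X i) p := by
      rw [Finset.prod_eq_single i]
      · simp
      · intro j _ hj; simp [hj]
      · simp
    rw [e1, mul_comm]
  exact congrArg (fun φ => φ h) this

theorem dslF_map {σ k A : Type*} [Fintype σ] [CommRing k] [CommRing A] [Algebra k A]
    (w : σ → ℕ → k) (h : MvPolynomial σ k) :
    dslF (fun i m => algebraMap k A (w i m)) (MvPolynomial.map (algebraMap k A) h) =
      algebraMap k A (dslF w h) := by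
  induction h using MvPolynomial.induction_on' with
  | monomial m a =>
    rw [MvPolynomial.map_monomial, ← mul_one a, ← smul_eq_mul, ← MvPolynomial.smul_monomial,
      smul_eq_mul, map_mul, map_one, ← smul_eq_mul (algebraMap k A a), ← MvPolynomial.smul_monomial,
      map_smul, map_smul, dslF_monomial, dslF_monomial, smul_eq_mul, smul_eq_mul, map_mul, map_prod]
  | add p q hp hq => simp only [map_add, hp, hq]

theorem dslL_map {k A : Type*} [CommRing k] [CommRing A] [Algebra k A]
    (w : ℕ → k) (h : Polynomial k) :
    dslL (fun m => algebraMap k A (w m)) (h.map (algebraMap k A)) =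
      algebraMap k A (dslL w h) := by
  induction h using Polynomial.induction_on' with
  | monomial m a =>
    rw [Polynomial.map_monomial, ← Polynomial.C_mul_X_pow_eq_monomial,
      ← Polynomial.C_mul_X_pow_eq_monomial, ← Polynomial.smul_eq_C_mul, ← Polynomial.smul_eq_C_mul,
      map_smul, map_smul, dslL_X_pow, dslL_X_pow, smul_eq_mul, smul_eq_mul, map_mul]
  | add p q hp hq => simp only [Polynomial.map_add, map_add, hp, hq]

/-- residue weights of a monic polynomial -/
noncomputable def dslW {k : Type*} [CommRing k] (p : Polynomial k) (m : ℕ) : k :=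
  ((Polynomial.X ^ m) %ₘ p).coeff (p.natDegree - 1)

theorem dslL_W {k : Type*} [CommRing k] (p h : Polynomial k) :
    dslL (dslW p) h = (h %ₘ p).coeff (p.natDegree - 1) := by
  have : dslL (dslW p) = (Polynomial.lcoeff k (p.natDegree - 1)).comp (Polynomial.modByMonicHom p) := by
    refine (Polynomial.basisMonomials k).ext fun m => ?_
    simp only [Polynomial.coe_basisMonomials, ← Polynomial.X_pow_eq_monomial, dslL_X_pow]
    rfl
  exact congrArg (fun φ => φ h) this

/-- value on a monic polynomial of degree `N - 1` -/
theorem dslL_W_monic {k A : Type*} [CommRing k] [CommRing A] [Algebra k A] [Nontrivial k]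
    (p : Polynomial k) (hp : p.Monic) (e : Polynomial A) (he : e.Monic)
    (hd : e.natDegree + 1 = p.natDegree) :
    dslL (fun m => algebraMap k A (dslW p m)) e = 1 := by
  have hw : ∀ m, m < p.natDegree → dslW p m = if m = e.natDegree then 1 else 0 := by
    intro m hm
    rw [dslW, (Polynomial.modByMonic_eq_self_iff hp).2, Polynomial.coeff_X_pow, ← hd]
    · simp [eq_comm]
    · rw [Polynomial.degree_X_pow, Polynomial.degree_eq_natDegree hp.ne_zero]
      exact_mod_cast hm
  rw [e.as_sum_range_C_mul_X_pow, map_sum, Finset.sum_eq_single e.natDegree]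
  · rw [← Polynomial.smul_eq_C_mul, map_smul, dslL_X_pow, hw _ (by omega)]
    simp [he.coeff_natDegree]
  · intro m hm hne
    rw [← Polynomial.smul_eq_C_mul, map_smul, dslL_X_pow,
      hw _ (by have := Finset.mem_range.1 hm; omega)]
    simp [hne]
  · simp

theorem dsl_split {k R A ι : Type*} [CommRing k] [AddCommGroup R] [Module k R] [CommRing A]
    [Algebra k A] [Fintype ι] {F : Type*} [FunLike F R A] [LinearMapClass F k R A]
    (π : F) (hπ : Function.Surjective π)
    (τ : ι → R →ₗ[k] k) (c : ι → A) (hτ : ∀ h, π h = 0 → ∀ m, τ m h = 0)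
    (key : ∀ h, π h = ∑ m, τ m h • c m) : Module.Projective k A := by
  choose s hs using hπ
  have hτs : ∀ m h, τ m (s (π h)) = τ m h := by
    intro m h
    rw [← sub_eq_zero, ← map_sub]
    exact hτ _ (by rw [map_sub, hs, sub_self]) m
  let μ : A →ₗ[k] (ι → k) :=
    { toFun := fun y m => τ m (s y)
      map_add' := fun y z => by
        funext m
        rw [Pi.add_apply, ← map_add, ← hτs m (s y + s z), map_add, hs, hs]
      map_smul' := fun r y => by
        funext m
        rw [RingHom.id_apply, Pi.smul_apply, ← map_smul, ← hτs m (r • s y), map_smul, hs] }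
  refine Module.Projective.of_split μ (Fintype.linearCombination k c) ?_
  refine LinearMap.ext fun y => ?_
  conv_rhs => rw [← hs y, key (s y)]
  rfl

set_option maxHeartbeats 1000000 in
open MvPolynomial in
theorem dsl_main {k σ A : Type*} [CommRing k] [Fintype σ] [DecidableEq σ]
    [CommRing A] [Algebra k A] (f : σ → MvPolynomial σ k)
    (π : MvPolynomial σ k →ₐ[k] A) (hπ : Function.Surjective π)
    (hker : ∀ h, π h = 0 ↔ h ∈ Ideal.span (Set.range f))
    (hfin : Module.Finite k A) : Module.Projective k A := by
  classical
  rcases subsingleton_or_nontrivial A with hA | hA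
  · infer_instance
  have hk : Nontrivial k := (algebraMap k A).domain_nontrivial
  let ι : MvPolynomial σ k →+* MvPolynomial σ A := MvPolynomial.map (algebraMap k A)
  let x : σ → A := fun i => π (X i)
  have hx : ∀ h : MvPolynomial σ k, eval x (ι h) = π h := by
    intro h
    have : (aeval x : MvPolynomial σ k →ₐ[k] A) = π := by
      apply MvPolynomial.algHom_ext
      intro i; simp [x]
    rw [← this, eval_map, aeval_def]
  choose p hpm hp0 using fun i => Algebra.IsIntegral.isIntegral (R := k) (x i)
  have hp0' : ∀ i, ((p i).map (algebraMap k A)).IsRoot (x i) := by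
    intro i
    rw [Polynomial.IsRoot, Polynomial.eval_map]; exact hp0 i
  have hdeg : ∀ i, 1 ≤ (p i).natDegree := by
    intro i
    by_contra hlt
    have h1 : p i = 1 := (hpm i).natDegree_eq_zero.1 (by omega)
    have := hp0 i
    rw [h1] at this
    simp at this
  let g : σ → MvPolynomial σ k := fun i => Polynomial.aeval (X i) (p i)
  have hg : ∀ i, g i ∈ Ideal.span (Set.range f) := by
    intro i
    rw [← hker, ← Polynomial.aeval_algHom_apply]
    exact hp0 i
  have hιg : ∀ i, ι (g i) = Polynomial.aeval (X i) ((p i).map (algebraMap k A)) := by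
    intro i
    simp only [g, ι]
    rw [Polynomial.aeval_def, Polynomial.hom_eval₂, Polynomial.aeval_def, Polynomial.eval₂_map]
    congr 1
    · ext r; simp
    · simp
  choose a ha using fun i => Ideal.mem_span_range_iff_exists_fun.1 (hg i)
  have hfx : ∀ i, ι (f i) ∈ Ideal.span (Set.range fun i => (X i - C (x i) : MvPolynomial σ A)) := by
    intro i
    have := dsl_sub_C_eval_mem x (ι (f i))
    rw [hx, (hker _).2 (Ideal.subset_span ⟨i, rfl⟩)] at this
    simpa using this
  choose c hc using fun i => Ideal.mem_span_range_iff_exists_fun.1 (hfx i)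
  let t : σ → MvPolynomial σ A := fun i => X i - C (x i)
  let e : σ → Polynomial A := fun i =>
    (p i).map (algebraMap k A) /ₘ (Polynomial.X - Polynomial.C (x i))
  have he : ∀ i, (Polynomial.X - Polynomial.C (x i)) * e i = (p i).map (algebraMap k A) :=
    fun i => Polynomial.mul_divByMonic_eq_iff_isRoot.2 (hp0' i)
  have hem : ∀ i, (e i).Monic := fun i =>
    (Polynomial.monic_X_sub_C (x i)).of_mul_monic_left (by rw [he]; exact (hpm i).map _)
  have hed : ∀ i, (e i).natDegree + 1 = (p i).natDegree := by
    intro i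
    have := (Polynomial.monic_X_sub_C (x i)).natDegree_mul (hem i)
    rw [he, (hpm i).natDegree_map, Polynomial.natDegree_X_sub_C] at this
    omega
  let E : σ → MvPolynomial σ A := fun i => Polynomial.aeval (X i) (e i)
  have hE : ∀ i, E i * t i = ι (g i) := by
    intro i
    rw [hιg, ← he]
    simp [E, t, mul_comm]
  let Ma : Matrix σ σ (MvPolynomial σ k) := Matrix.of a
  let Mc : Matrix σ σ (MvPolynomial σ A) := Matrix.of c
  have hMa : Ma.mulVec f = g := funext fun i => ha i
  have hMc : Mc.mulVec t = fun i => ι (f i) := funext fun i => hc i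
  have hdet : (ι.mapMatrix Ma * Mc).det - (Matrix.diagonal E).det ∈
      Ideal.span (Set.range fun i => ι (g i)) := by
    refine dsl_det t _ ?_ _ _ ?_ ?_
    · intro i v q hq h
      have := dsl_cancel_mem x (fun i => (p i).map (algebraMap k A)) i v q hq
        (by simp only [← hιg]; exact h)
      simpa only [← hιg] using this
    · rw [← Matrix.mulVec_mulVec, hMc]
      funext i
      rw [← hMa, RingHom.map_mulVec]
      rfl
    · funext i
      rw [Matrix.mulVec_diagonal, hE]
  let w : σ → ℕ → k := fun i => dslW (p i)
  let φ := dslF w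
  let Φ := dslF (fun i m => algebraMap k A (w i m))
  have hΦφ : ∀ h, Φ (ι h) = algebraMap k A (φ h) := fun h => dslF_map w h
  have hφg : ∀ h ∈ Ideal.span (Set.range g), φ h = 0 := by
    intro h hh
    obtain ⟨b, rfl⟩ := Ideal.mem_span_range_iff_exists_fun.1 hh
    rw [map_sum]
    refine Finset.sum_eq_zero fun i _ => dslF_mul_eq_zero w i (p i) (fun m => ?_) _
    rw [dslL_W, (Polynomial.modByMonic_eq_zero_iff_dvd (hpm i)).2 (Dvd.intro _ rfl)]
    simp
  have hΦg : ∀ h ∈ Ideal.span (Set.range fun i => ι (g i)), Φ h = 0 := by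
    intro h hh
    obtain ⟨b, rfl⟩ := Ideal.mem_span_range_iff_exists_fun.1 hh
    rw [map_sum]
    refine Finset.sum_eq_zero fun i _ => ?_
    rw [hιg]
    refine dslF_mul_eq_zero _ i _ (fun m => ?_) _
    have := dslL_map (A := A) (w i) (p i * Polynomial.X ^ m)
    rw [dslL_W, (Polynomial.modByMonic_eq_zero_iff_dvd (hpm i)).2 (Dvd.intro _ rfl)] at this
    simpa using this
  have hΦE : Φ (∏ i, E i) = 1 := by
    rw [dslF_prod]
    exact Finset.prod_eq_one fun i _ => dslL_W_monic (p i) (hpm i) (e i) (hem i) (hed i)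
  have hΦEh : ∀ h, Φ ((∏ i, E i) * h) = eval x h := by
    intro h
    obtain ⟨b, hb⟩ := Ideal.mem_span_range_iff_exists_fun.1 (dsl_sub_C_eval_mem x h)
    have h1 : (∏ i, E i) * h - (∏ i, E i) * C (eval x h) ∈
        Ideal.span (Set.range fun i => ι (g i)) := by
      rw [← mul_sub, ← hb, Finset.mul_sum]
      refine Ideal.sum_mem _ fun i _ => ?_
      rw [← Finset.mul_prod_erase _ _ (Finset.mem_univ i)]
      have : E i * (∏ j ∈ Finset.univ.erase i, E j) * (b i * (X i - C (x i))) =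
          ((∏ j ∈ Finset.univ.erase i, E j) * b i) * ι (g i) := by
        rw [← hE]; simp only [t]; ring
      rw [this]
      exact Ideal.mul_mem_left _ _ (Ideal.subset_span ⟨i, rfl⟩)
    have h2 := hΦg _ h1
    rw [map_sub, sub_eq_zero] at h2
    rw [h2, mul_comm, ← smul_eq_C_mul, map_smul, hΦE, smul_eq_mul, mul_one]
  let d := Ma.det
  let D := Mc.det
  have hdf : ∀ h ∈ Ideal.span (Set.range f), d * h ∈ Ideal.span (Set.range g) := by
    intro h hh
    obtain ⟨b, rfl⟩ := Ideal.mem_span_range_iff_exists_fun.1 hh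
    rw [Finset.mul_sum]
    refine Ideal.sum_mem _ fun i _ => ?_
    have h1 := congrArg (fun v => (Ma.adjugate.mulVec v) i) hMa
    simp only [Matrix.mulVec_mulVec, Matrix.adjugate_mul, Matrix.smul_mulVec, Matrix.one_mulVec,
        Pi.smul_apply, smul_eq_mul] at h1
    rw [show d * (b i * f i) = b i * (d * f i) by ring, h1]
    refine Ideal.mul_mem_left _ _ (Ideal.sum_mem _ fun j _ => ?_)
    exact Ideal.mul_mem_left _ _ (Ideal.subset_span ⟨j, rfl⟩)
  have key : ∀ h : MvPolynomial σ k, π h =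
      ∑ m ∈ D.support, φ (monomial m 1 * d * h) • D.coeff m := by
    intro h
    have h1 : (ι.mapMatrix Ma * Mc).det * ι h - (∏ i, E i) * ι h ∈
        Ideal.span (Set.range fun i => ι (g i)) := by
      rw [← sub_mul, ← Matrix.det_diagonal]
      exact Ideal.mul_mem_right _ _ hdet
    have h2 := hΦg _ h1
    rw [map_sub, sub_eq_zero, hΦEh, hx, Matrix.det_mul, ← RingHom.map_det] at h2
    rw [← h2]
    have h3 : ι Ma.det * Mc.det * ι h =
        ∑ m ∈ D.support, D.coeff m • ι (monomial m 1 * d * h) := by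
      conv_lhs => rw [show Mc.det = D from rfl, D.as_sum]
      rw [Finset.mul_sum, Finset.sum_mul]
      refine Finset.sum_congr rfl fun m _ => ?_
      have : (monomial m (D.coeff m) : MvPolynomial σ A) = C (D.coeff m) * ι (monomial m 1) := by
        simp [ι, C_mul_monomial]
      rw [this, smul_eq_C_mul, map_mul, map_mul]
      ring
    rw [h3, map_sum]
    refine Finset.sum_congr rfl fun m _ => ?_
    rw [map_smul, hΦφ, Algebra.smul_def (φ _), smul_eq_mul, mul_comm]
  refine dsl_split π hπ
    (fun m : D.support => φ.comp (LinearMap.mulLeft k (monomial m.1 1 * d)))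
    (fun m => D.coeff m.1) ?_ ?_
  · intro h hh m
    simp only [LinearMap.comp_apply, LinearMap.mulLeft_apply]
    rw [mul_assoc]
    exact hφg _ (Ideal.mul_mem_left _ _ (hdf h ((hker h).1 hh)))
  · intro h
    rw [key h, ← Finset.sum_coe_sort]
    rfl


/-- (de Smit–Lenstra) If `A = k[X₁,…,Xₙ]/(f₁,…,fₙ)` (as many polynomials as variables)
is finitely generated as a `k`-module, then `A` is a finitely generated projective
`k`-module. -/
theorem deSmit_Lenstra_finite_projective
    {k : Type*} [CommRing k] {n : ℕ} (f : Fin n → MvPolynomial (Fin n) k)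
    (hfin : Module.Finite k (MvPolynomial (Fin n) k ⧸ Ideal.span (Set.range f))) :
    Module.Finite k (MvPolynomial (Fin n) k ⧸ Ideal.span (Set.range f)) ∧
      Module.Projective k (MvPolynomial (Fin n) k ⧸ Ideal.span (Set.range f)) := by
  exact ⟨hfin, dsl_main f (Ideal.Quotient.mkₐ k _) (Ideal.Quotient.mkₐ_surjective k _)
    (fun _ => Ideal.Quotient.eq_zero_iff_mem) hfin⟩
end
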